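/- The contravariant metric on the open set {(u¹,u²) ∈ ℝ² : u¹ ≠ 0} with components ℓ¹¹ = 1, ℓ¹² = ℓ²¹ = u²/u¹, ℓ²² = ((u²)² + 1)/(u¹)² (which has det(ℓ^{ij}) = 1/(u¹)² ≠ 0) is not flat: its Riemann curvature tensor does not vanish identically. -/

import Mathlib

open Matrix

/-- Partial derivative in direction `i` (0 ↦ ∂/∂u¹, 1 ↦ ∂/∂u²) of a function of
two real variables. -/
noncomputable def pd (i : Fin 2) (f : ℝ → ℝ → ℝ) (x y : ℝ) : ℝ :=
  if i = 0 then deriv (fun s => f s y) x else deriv (fun s => f x s) y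

/-- The covariant components `g_{lk}` of a contravariant metric `g`, i.e. the
entries of the inverse matrix. -/
noncomputable def covMetric (g : ℝ → ℝ → Matrix (Fin 2) (Fin 2) ℝ)
    (l k : Fin 2) (x y : ℝ) : ℝ :=
  ((g x y)⁻¹) l k

/-- Christoffel symbols `Γ^i_{jk}` of the Levi-Civita connection of the
contravariant metric `g`:
`Γ^i_{jk} = (1/2) g^{il} (∂_j g_{lk} + ∂_k g_{lj} − ∂_l g_{jk})`. -/
noncomputable def christoffel (g : ℝ → ℝ → Matrix (Fin 2) (Fin 2) ℝ)
    (i j k : Fin 2) (x y : ℝ) : ℝ :=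
  ∑ l, (1 / 2 : ℝ) * g x y i l *
    (pd j (covMetric g l k) x y + pd k (covMetric g l j) x y
      - pd l (covMetric g j k) x y)

/-- Riemann curvature tensor
`R^i_{jkl} = ∂_k Γ^i_{lj} − ∂_l Γ^i_{kj} + Γ^i_{km} Γ^m_{lj} − Γ^i_{lm} Γ^m_{kj}`. -/
noncomputable def riemann (g : ℝ → ℝ → Matrix (Fin 2) (Fin 2) ℝ)
    (i j k l : Fin 2) (x y : ℝ) : ℝ :=
  pd k (christoffel g i l j) x y - pd l (christoffel g i k j) x y
    + ∑ m, (christoffel g i k m x y * christoffel g m l j x y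
        - christoffel g i l m x y * christoffel g m k j x y)

/-- Abbreviation for the metric. -/
noncomputable def gm : ℝ → ℝ → Matrix (Fin 2) (Fin 2) ℝ :=
  fun a b => !![(1 : ℝ), b / a; b / a, (b ^ 2 + 1) / a ^ 2]

/-- The inverse metric. -/
def gi : ℝ → ℝ → Matrix (Fin 2) (Fin 2) ℝ :=
  fun a b => !![b ^ 2 + 1, -(a * b); -(a * b), a ^ 2]

theorem gm_inv (x y : ℝ) (hx : x ≠ 0) : (gm x y)⁻¹ = gi x y := by
  apply Matrix.inv_eq_right_inv
  ext i j
  fin_cases i <;> fin_cases j <;> simp [gm, gi, Matrix.mul_apply, Fin.sum_univ_two] <;>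
    field_simp <;> ring

theorem pd_congr (f h : ℝ → ℝ → ℝ) (H : ∀ x y, x ≠ 0 → f x y = h x y) (i : Fin 2)
    (x y : ℝ) (hx : x ≠ 0) : pd i f x y = pd i h x y := by
  unfold pd
  split_ifs
  · apply Filter.EventuallyEq.deriv_eq
    filter_upwards [isOpen_ne.mem_nhds hx] with s hs
    exact H s y hs
  · congr 1
    funext s
    exact H x s hx

theorem pd_cov (i l k : Fin 2) (x y : ℝ) (hx : x ≠ 0) :
    pd i (covMetric gm l k) x y = pd i (fun a b => gi a b l k) x y :=
  pd_congr _ _ (fun a b ha => by simp only [covMetric, gm_inv a b ha]) i x y hx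

theorem pd0 (f : ℝ → ℝ → ℝ) (x y : ℝ) : pd 0 f x y = deriv (fun s => f s y) x := by
  simp [pd]

theorem pd1 (f : ℝ → ℝ → ℝ) (x y : ℝ) : pd 1 f x y = deriv (fun s => f x s) y := by
  simp [pd]

theorem chr_all (x y : ℝ) (hx : x ≠ 0) :
    christoffel gm 0 0 0 x y = -2 * y ^ 2 / x ∧
    christoffel gm 0 0 1 x y = 2 * y ∧
    christoffel gm 0 1 0 x y = 2 * y ∧
    christoffel gm 0 1 1 x y = -2 * x ∧
    christoffel gm 1 0 1 x y = (2 * y ^ 2 + 1) / x ∧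
    christoffel gm 1 1 1 x y = -2 * y := by
  refine ⟨?_, ?_, ?_, ?_, ?_, ?_⟩ <;>
    simp [christoffel, Fin.sum_univ_two, pd_cov _ _ _ x y hx, pd0, pd1, gi, gm] <;>
    field_simp <;> ring

/-- The leading-term metric `ℓ⁽³⁾` of the third-order operator `R₃⁽³⁾`,
`ℓ¹¹ = 1`, `ℓ¹² = ℓ²¹ = u²/u¹`, `ℓ²² = ((u²)² + 1)/(u¹)²`, which is
non-degenerate on `{u¹ ≠ 0}` (its determinant is `1/(u¹)²`), is NOT flat:
its Riemann curvature tensor does not vanish identically there. -/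
theorem not_flat_leading_metric_R3_3 :
    (∀ x y : ℝ, x ≠ 0 →
      Matrix.det (!![(1 : ℝ), y / x; y / x, (y ^ 2 + 1) / x ^ 2]) = 1 / x ^ 2 ∧
      Matrix.det (!![(1 : ℝ), y / x; y / x, (y ^ 2 + 1) / x ^ 2]) ≠ 0) ∧
    ¬ (∀ x y : ℝ, x ≠ 0 →
        ∀ i j k l : Fin 2,
          riemann (fun a b => !![(1 : ℝ), b / a; b / a, (b ^ 2 + 1) / a ^ 2])
            i j k l x y = 0) := by
  constructor
  · intro x y hx
    have h : Matrix.det (!![(1 : ℝ), y / x; y / x, (y ^ 2 + 1) / x ^ 2]) = 1 / x ^ 2 := by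
      rw [Matrix.det_fin_two_of]
      field_simp
      ring
    refine ⟨h, ?_⟩
    rw [h]
    positivity
  · intro H
    have h : riemann gm 0 1 0 1 1 0 = 0 := H 1 0 one_ne_zero 0 1 0 1
    have e1 : pd 0 (christoffel gm 0 1 1) 1 0 = -2 := by
      rw [pd_congr _ (fun a _ => -2 * a) (fun a b ha => (chr_all a b ha).2.2.2.1) 0 1 0
        one_ne_zero, pd0]
      simp
    have e2 : pd 1 (christoffel gm 0 0 1) 1 0 = 2 := by
      rw [pd_congr _ (fun _ b => 2 * b) (fun a b ha => (chr_all a b ha).2.1) 1 1 0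
        one_ne_zero, pd1]
      simp
    obtain ⟨c1, c2, c3, c4, c5, c6⟩ := chr_all 1 0 one_ne_zero
    simp only [riemann, Fin.sum_univ_two, e1, e2, c1, c2, c3, c4, c5, c6] at h
    norm_num at h
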